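/- Let n be even, let W(i) := (n − 2i)(n + 2 − 2i)/(2n) for i ∈ {0,1,…,n/2}, let π(i) = (C(n,i) − C(n,i−1))/C(n, n/2) for 1 ≤ i ≤ n/2 and π(0) = 1/C(n, n/2), and let K be the birth-death transition matrix on {0,1,…,n/2} with K(i,i+1) := (n−i+1)/(n(n−2i)(n−2i+1)) for i < n/2, K(n/2, n/2+1) := 0, K(i,i−1) := i/(n(n−2i+1)(n−2i+2)), and K(i,i) := 1 − K(i,i+1) − K(i,i−1). Let c := (4/n)·(⌈√((5/2)·n·log n)⌉ + 1). Then Σ_{i,j} π(i)·K(i,j)·1[|W(j) − W(i)| > c] ≤ n^{−5/2}. -/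

import Mathlib

open Finset

/-- The spectral measure of the Bernoulli-Laplace chain. -/
noncomputable def piBL (n i : ℕ) : ℝ :=
  if i = 0 then 1 / (n.choose (n / 2) : ℝ)
  else ((n.choose i : ℝ) - (n.choose (i - 1) : ℝ)) / (n.choose (n / 2) : ℝ)

/-- The rescaled eigenvalue `W(i) = (n-2i)(n+2-2i)/(2n)`. -/
noncomputable def WBL (n i : ℕ) : ℝ :=
  ((n : ℝ) - 2 * i) * ((n : ℝ) + 2 - 2 * i) / (2 * n)

/-- Up-transition probability of the first birth-death chain:
`K(i,i+1) = (n-i+1)/(n(n-2i)(n-2i+1))` for `i < n/2`, and `K(n/2, n/2+1) = 0`. -/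
noncomputable def upBL (n i : ℕ) : ℝ :=
  if i < n / 2 then ((n : ℝ) - i + 1) / ((n : ℝ) * ((n : ℝ) - 2 * i) * ((n : ℝ) - 2 * i + 1))
  else 0

/-- Down-transition probability: `K(i,i-1) = i/(n(n-2i+1)(n-2i+2))`. -/
noncomputable def downBL (n i : ℕ) : ℝ :=
  (i : ℝ) / ((n : ℝ) * ((n : ℝ) - 2 * i + 1) * ((n : ℝ) - 2 * i + 2))

/-- The birth-death transition matrix of Subsection 4.1. -/
noncomputable def KBL (n i j : ℕ) : ℝ :=
  if j = i + 1 then upBL n i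
  else if i = j + 1 then downBL n i
  else if i = j then 1 - upBL n i - downBL n i
  else 0

/-- `M_m(i) = Σ_j K(i,j) (W(j) - W(i))^m`, the `m`-th conditional moment of the increment. -/
noncomputable def MBL (n m i : ℕ) : ℝ :=
  ∑ j ∈ Finset.range (n / 2 + 1), KBL n i j * (WBL n j - WBL n i) ^ m

/-- The spectral measure telescopes. -/
theorem sum_range_piBL (n t : ℕ) :
    ∑ i ∈ Finset.range (t + 1), piBL n i = (n.choose t : ℝ) / (n.choose (n / 2) : ℝ) := by
  induction t with
  | zero => simp [piBL]
  | succ t ih =>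
    rw [Finset.sum_range_succ, ih, piBL, if_neg t.succ_ne_zero, Nat.add_sub_cancel]
    ring

theorem piBL_nonneg {n i : ℕ} (hi : i ≤ n / 2) : 0 ≤ piBL n i := by
  unfold piBL
  split_ifs with h0
  · positivity
  · obtain ⟨k, rfl⟩ := Nat.exists_eq_succ_of_ne_zero h0
    have h : n.choose k ≤ n.choose (k + 1) := Nat.choose_le_succ_of_lt_half_left (by omega)
    have h' : (n.choose k : ℝ) ≤ n.choose (k + 1) := by exact_mod_cast h
    exact div_nonneg (by simpa using h') (by positivity)

/-- A Gaussian bound for the binomial coefficients away from the centre. -/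
theorem choose_sub_le_choose_mul_exp (h k : ℕ) (hk : k ≤ h) :
    ((2 * h).choose (h - k) : ℝ) ≤
      (2 * h).choose h * Real.exp (-((k : ℝ) ^ 2 / (2 * h))) := by
  induction k with
  | zero => simp
  | succ k ih =>
    obtain ⟨r, rfl⟩ := Nat.exists_eq_add_of_le hk
    have e1 : k + 1 + r - (k + 1) = r := by omega
    have e2 : k + 1 + r - k = r + 1 := by omega
    have ih := ih (by omega)
    rw [e2] at ih
    rw [e1]
    set H : ℝ := ((k + 1 + r : ℕ) : ℝ) with hH
    have hHe : H = k + 1 + r := by rw [hH]; push_cast; ring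
    have hrec := Nat.choose_succ_right_eq (2 * (k + 1 + r)) r
    have e3 : 2 * (k + 1 + r) - r = 2 * k + 2 + r := by omega
    rw [e3] at hrec
    have hrec' : ((2 * (k + 1 + r)).choose (r + 1) : ℝ) * (r + 1) =
        (2 * (k + 1 + r)).choose r * (2 * k + 2 + r) := by exact_mod_cast hrec
    have hpos : (0 : ℝ) < 2 * k + 2 + r := by positivity
    have hHpos : 0 < H := by rw [hHe]; positivity
    have hratio : ((r : ℝ) + 1) / (2 * k + 2 + r) ≤ Real.exp (-((2 * k + 1) / (2 * H))) := by
      calc ((r : ℝ) + 1) / (2 * k + 2 + r) = 1 - (2 * k + 1) / (2 * k + 2 + r) := by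
            field_simp; ring
        _ ≤ 1 - (2 * k + 1) / (2 * H) := by
            have : (2 * k + 1) / (2 * H) ≤ (2 * (k : ℝ) + 1) / (2 * k + 2 + r) := by
              apply div_le_div_of_nonneg_left (by positivity) hpos
              rw [hHe]
              linarith [Nat.cast_nonneg (α := ℝ) r]
            linarith
        _ ≤ _ := by linarith [Real.add_one_le_exp (-((2 * (k : ℝ) + 1) / (2 * H)))]
    calc ((2 * (k + 1 + r)).choose r : ℝ)
        = (2 * (k + 1 + r)).choose (r + 1) * (((r : ℝ) + 1) / (2 * k + 2 + r)) := by
          rw [← mul_div_assoc, hrec']; field_simp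
      _ ≤ ((2 * (k + 1 + r)).choose (k + 1 + r) * Real.exp (-((k : ℝ) ^ 2 / (2 * H)))) *
            Real.exp (-((2 * k + 1) / (2 * H))) := by gcongr
      _ = _ := by
          rw [mul_assoc, ← Real.exp_add]
          congr 2
          push_cast
          field_simp
          ring

theorem WBL_succ_sub {n : ℕ} (hn : 0 < n) (i : ℕ) :
    WBL n (i + 1) - WBL n i = -(2 * ((n : ℝ) - 2 * i) / n) := by
  have : (n : ℝ) ≠ 0 := by positivity
  unfold WBL
  push_cast
  field_simp
  ring

/-- An increment of `W` along a step of the chain exceeds `4(m+1)/n` only when the starting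
state is at distance more than `m` from the centre. -/
theorem KBL_mul_indicator_eq_zero {h m i j : ℕ} (hh : 0 < h) (hi : i ≤ h) (him : h ≤ i + m) :
    KBL (2 * h) i j *
      (if (4 / ((2 * h : ℕ) : ℝ)) * ((m : ℝ) + 1) < |WBL (2 * h) j - WBL (2 * h) i|
        then (1 : ℝ) else 0) = 0 := by
  have hpos : (0 : ℝ) < h := by exact_mod_cast hh
  have hi' : (i : ℝ) ≤ h := by exact_mod_cast hi
  have him' : (h : ℝ) ≤ i + m := by exact_mod_cast him
  have key : |WBL (2 * h) j - WBL (2 * h) i| ≤ (4 / ((2 * h : ℕ) : ℝ)) * ((m : ℝ) + 1) ∨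
      KBL (2 * h) i j = 0 := by
    by_cases h1 : j = i + 1
    · left
      rw [h1, WBL_succ_sub (by omega), abs_neg, abs_of_nonneg]
      · push_cast
        rw [div_mul_eq_mul_div]
        gcongr ?_ / _
        linarith
      · push_cast
        apply div_nonneg <;> linarith
    by_cases h2 : i = j + 1
    · left
      have h2' : (i : ℝ) = j + 1 := by exact_mod_cast h2
      rw [abs_sub_comm, h2, WBL_succ_sub (by omega), abs_neg, abs_of_nonneg]
      · push_cast
        rw [div_mul_eq_mul_div]
        gcongr ?_ / _
        linarith
      · push_cast
        apply div_nonneg <;> linarith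
    by_cases h3 : i = j
    · left
      rw [h3, sub_self, abs_zero]
      positivity
    · right
      simp [KBL, h1, h2, h3]
  rcases key with hle | h0
  · rw [if_neg (not_lt.mpr hle), mul_zero]
  · rw [h0, zero_mul]

theorem upBL_nonneg {h i : ℕ} (hi : i < h) : 0 ≤ upBL (2 * h) i := by
  have hi' : (i : ℝ) + 1 ≤ h := by exact_mod_cast hi
  have := Nat.cast_nonneg (α := ℝ) i
  unfold upBL
  split_ifs
  · push_cast
    apply div_nonneg
    · linarith
    · apply mul_nonneg (mul_nonneg _ _) <;> linarith
  · rfl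

theorem downBL_nonneg {h i : ℕ} (hi : i < h) : 0 ≤ downBL (2 * h) i := by
  have hi' : (i : ℝ) + 1 ≤ h := by exact_mod_cast hi
  have := Nat.cast_nonneg (α := ℝ) i
  unfold downBL
  push_cast
  apply div_nonneg this
  apply mul_nonneg (mul_nonneg _ _) <;> linarith

theorem upBL_add_downBL_le_one {h i : ℕ} (hi : i < h) :
    upBL (2 * h) i + downBL (2 * h) i ≤ 1 := by
  obtain ⟨r, rfl⟩ := Nat.exists_eq_add_of_le (Nat.succ_le_of_lt hi)
  have hr := Nat.cast_nonneg (α := ℝ) r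
  have hi0 := Nat.cast_nonneg (α := ℝ) i
  rw [upBL, if_pos (by omega), downBL]
  push_cast
  have hu : (2 * ((i : ℝ) + 1 + r) - i + 1) /
      (2 * ((i : ℝ) + 1 + r) * (2 * (i + 1 + r) - 2 * i) * (2 * (i + 1 + r) - 2 * i + 1)) ≤ 1 / 2 := by
    rw [div_le_iff₀ (by
      apply mul_pos (mul_pos _ _) <;> linarith)]
    have : (6 : ℝ) ≤ (2 * (i + 1 + r) - 2 * i) * (2 * (i + 1 + r) - 2 * i + 1) := by nlinarith
    nlinarith
  have hd : (i : ℝ) /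
      (2 * ((i : ℝ) + 1 + r) * (2 * (i + 1 + r) - 2 * i + 1) * (2 * (i + 1 + r) - 2 * i + 2)) ≤
      1 / 2 := by
    rw [div_le_iff₀ (by
      apply mul_pos (mul_pos _ _) <;> linarith)]
    have : (6 : ℝ) ≤ (2 * (i + 1 + r) - 2 * i + 1) * (2 * (i + 1 + r) - 2 * i + 2) := by nlinarith
    nlinarith
  linarith

/-- The probability of a jump out of a state strictly below the centre is at most one. -/
theorem sum_KBL_mul_indicator_le_one {h i : ℕ} (hi : i < h) {c : ℝ} (hc : 0 ≤ c) (s : Finset ℕ) :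
    ∑ j ∈ s, KBL (2 * h) i j *
      (if c < |WBL (2 * h) j - WBL (2 * h) i| then (1 : ℝ) else 0) ≤ 1 := by
  have hu := upBL_nonneg hi
  have hd := downBL_nonneg hi
  calc _ ≤ ∑ j ∈ s, ((if j = i + 1 then upBL (2 * h) i else 0) +
          (if j = i - 1 then downBL (2 * h) i else 0)) := by
        refine Finset.sum_le_sum fun j _ => ?_
        by_cases h3 : i = j
        · subst h3
          rw [sub_self, abs_zero, if_neg (not_lt.mpr hc), mul_zero]
          split_ifs <;> linarith
        · unfold KBL
          split_ifs <;> first | omega | simp [hu, hd]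
    _ ≤ upBL (2 * h) i + downBL (2 * h) i := by
        rw [Finset.sum_add_distrib, Finset.sum_ite_eq', Finset.sum_ite_eq']
        split_ifs <;> linarith
    _ ≤ 1 := upBL_add_downBL_le_one hi

/-- Proposition 4.5 (concen): the concentration inequality `P(|W' - W| > c) ≤ n^{-5/2}`
for `c = (4/n)(⌈√((5/2) n log n)⌉ + 1)`. -/
theorem concentration_inequality (n : ℕ) (hn : Even n) (hpos : 0 < n) :
    (∑ i ∈ Finset.range (n / 2 + 1), ∑ j ∈ Finset.range (n / 2 + 1),
        piBL n i * KBL n i j *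
          (if (4 / (n : ℝ)) * ((⌈Real.sqrt ((5 / 2) * n * Real.log n)⌉ : ℤ) + 1 : ℝ) <
              |WBL n j - WBL n i| then (1 : ℝ) else 0)) ≤
      (n : ℝ) ^ (-(5 : ℝ) / 2) := by
  obtain ⟨h, rfl⟩ := hn.exists_two_nsmul
  rw [smul_eq_mul] at *
  have hh : 0 < h := by omega
  set s := Real.sqrt ((5 / 2) * ((2 * h : ℕ) : ℝ) * Real.log ((2 * h : ℕ) : ℝ)) with hs
  obtain ⟨m, hm⟩ := Int.eq_ofNat_of_zero_le (Int.ceil_nonneg (Real.sqrt_nonneg _ : 0 ≤ s))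
  have hsm : s ≤ m := by
    have := Int.le_ceil s
    rwa [hm, Int.cast_natCast] at this
  rw [hm, Int.cast_natCast, Nat.mul_div_cancel_left h two_pos]
  simp_rw [mul_assoc (piBL _ _), ← Finset.mul_sum]
  rcases lt_or_ge m h with hmh | hmh
  swap
  · rw [Finset.sum_eq_zero]
    · positivity
    · intro i hi
      have hi := Finset.mem_range.mp hi
      rw [Finset.sum_eq_zero fun j _ =>
        KBL_mul_indicator_eq_zero hh (by omega) (by omega), mul_zero]
  have hchoose : (0 : ℝ) < (2 * h).choose h := by
    exact_mod_cast Nat.choose_pos (by omega)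
  calc _ ≤ ∑ i ∈ Finset.range (h - (m + 1) + 1), piBL (2 * h) i := by
        rw [← Finset.sum_subset (s₁ := Finset.range (h - (m + 1) + 1))]
        · refine Finset.sum_le_sum fun i hi => ?_
          have hi := Finset.mem_range.mp hi
          exact mul_le_of_le_one_right (piBL_nonneg (by omega))
            (sum_KBL_mul_indicator_le_one (by omega) (by positivity) _)
        · intro i hi
          simp only [Finset.mem_range] at hi ⊢
          omega
        · intro i hi hi'
          simp only [Finset.mem_range] at hi hi'
          rw [Finset.sum_eq_zero fun j _ =>
            KBL_mul_indicator_eq_zero hh (by omega) (by omega), mul_zero]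
    _ = ((2 * h).choose (h - (m + 1)) : ℝ) / (2 * h).choose h := by
        rw [sum_range_piBL, Nat.mul_div_cancel_left h two_pos]
    _ ≤ Real.exp (-(((m + 1 : ℕ) : ℝ) ^ 2 / (2 * h))) := by
        rw [div_le_iff₀' hchoose]
        exact choose_sub_le_choose_mul_exp h (m + 1) hmh
    _ ≤ _ := by
        have hn1 : (1 : ℝ) ≤ ((2 * h : ℕ) : ℝ) := by exact_mod_cast hpos
        have hlog := Real.log_nonneg hn1
        have hsq : s ^ 2 = (5 / 2) * ((2 * h : ℕ) : ℝ) * Real.log ((2 * h : ℕ) : ℝ) :=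
          Real.sq_sqrt (by positivity)
        have hs2 : s ^ 2 ≤ ((m + 1 : ℕ) : ℝ) ^ 2 := by
          gcongr
          push_cast
          linarith
        rw [Real.rpow_def_of_pos (by linarith), Real.exp_le_exp]
        have hle : (5 / 2) * Real.log ((2 * h : ℕ) : ℝ) ≤ ((m + 1 : ℕ) : ℝ) ^ 2 / (2 * h) := by
          rw [le_div_iff₀ (by positivity)]
          calc _ = s ^ 2 := by rw [hsq]; push_cast; ring
            _ ≤ _ := hs2
        linarith
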